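/- arXiv:1303.4005 — 2 statements merged into one kernel-verified Lean document; each statement's English description precedes it below -/
import Mathlib

section
/- Let Y₁, …, Yₙ be independent random vectors in ℝ^d with distributions Fₖ = L(Yₖ), and let λ₁, …, λₙ, λ be positive numbers with λₖ ≤ λ for all k. Assume Σₖ λₖ²(1 − Q(F̃ₖ, λₖ)) > 0. Then there exists an absolute constant c > 0 (independent of d and n) such that Q(L(Σₖ Yₖ), λ) ≤ c λ ( Σₖ λₖ² (1 − Q(F̃ₖ, λₖ)) )^{-1/2}. -/
open MeasureTheory

/-- Concentration function `Q(μ, r) = sup_x μ(x + rB)` of a measure on `ℝ^d`. -/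
noncomputable def concFn {d : ℕ} (μ : Measure (EuclideanSpace ℝ (Fin d))) (r : ℝ) : ℝ :=
  ⨆ x : EuclideanSpace ℝ (Fin d), (μ (Metric.closedBall x r)).toReal

/-- Law of the symmetrization `Ỹ = Y - Y'` of a random vector with law `μ`,
where `Y'` is an independent copy of `Y`. -/
noncomputable def symmLaw {d : ℕ} (μ : Measure (EuclideanSpace ℝ (Fin d))) :
    Measure (EuclideanSpace ℝ (Fin d)) :=
  (μ.prod μ).map (fun p => p.1 - p.2)

section

open ProbabilityTheory Real Filter Set
open scoped NNReal RealInnerProductSpace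

/-- Over one period, `exp (-N (1 - cos x))` is dominated by a Gaussian integral. -/
lemma integral_exp_neg_one_sub_cos_le {N : ℝ} (hN : 0 < N) :
    ∫ x in (0 : ℝ)..2 * π, exp (-N * (1 - cos x)) ≤ √(π ^ 3 / 2) / √N := by
  have hper : Function.Periodic (fun x : ℝ => exp (-N * (1 - cos x))) (2 * π) := fun x => by simp
  have hshift := hper.intervalIntegral_add_eq 0 (-π)
  rw [zero_add, show -π + 2 * π = π by ring] at hshift
  have hb : 0 < 2 * N / π ^ 2 := by positivity
  have hint := integrable_exp_neg_mul_sq hb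
  rw [hshift]
  calc ∫ x in (-π)..π, exp (-N * (1 - cos x))
      ≤ ∫ x in (-π)..π, exp (-(2 * N / π ^ 2) * x ^ 2) := by
        refine intervalIntegral.integral_mono_on (by linarith [pi_pos])
          (Continuous.intervalIntegrable (by fun_prop) _ _)
          (Continuous.intervalIntegrable (by fun_prop) _ _) fun x hx => ?_
        have := cos_le_one_sub_mul_cos_sq (abs_le.2 hx)
        rw [exp_le_exp]
        calc -N * (1 - cos x) ≤ -N * (2 / π ^ 2 * x ^ 2) := by nlinarith
          _ = _ := by ring
    _ ≤ ∫ x, exp (-(2 * N / π ^ 2) * x ^ 2) := by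
        rw [intervalIntegral.integral_of_le (by linarith [pi_pos])]
        exact setIntegral_le_integral hint (ae_of_all _ fun x => (exp_pos _).le)
    _ = √(π ^ 3 / 2) / √N := by
        rw [integral_gaussian, ← sqrt_div (by positivity)]
        congr 1
        field_simp

/-- Integral of a nonnegative periodic function against a nonnegative decreasing density. -/
lemma integral_periodic_mul_antitone_le {f ρ : ℝ → ℝ} {T : ℝ} (hT : 0 < T)
    (hf : Continuous f) (hf0 : ∀ x, 0 ≤ f x) (hper : Function.Periodic f T)
    (hρ : Continuous ρ) (hanti : AntitoneOn ρ (Ici 0)) (n : ℕ) :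
    ∫ x in (0 : ℝ)..(n + 1) * T, f x * ρ x ≤
      (∫ x in (0 : ℝ)..T, f x) * (ρ 0 + T⁻¹ * ∫ x in (0 : ℝ)..n * T, ρ x) := by
  have hblock : ∀ a : ℝ, 0 ≤ a →
      ∫ x in a..a + T, f x * ρ x ≤ (∫ x in (0 : ℝ)..T, f x) * ρ a := fun a ha => by
    have hI := hper.intervalIntegral_add_eq a 0
    rw [zero_add] at hI
    rw [← hI, ← intervalIntegral.integral_mul_const]
    refine intervalIntegral.integral_mono_on (by linarith)
      (Continuous.intervalIntegrable (by fun_prop) _ _)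
      (Continuous.intervalIntegrable (by fun_prop) _ _) fun x hx => ?_
    exact mul_le_mul_of_nonneg_left (hanti ha (ha.trans hx.1) hx.1) (hf0 x)
  have hI0 : 0 ≤ ∫ x in (0 : ℝ)..T, f x :=
    intervalIntegral.integral_nonneg hT.le fun x _ => hf0 x
  induction n with
  | zero => simpa using hblock 0 le_rfl
  | succ n ih =>
    have hn : (0 : ℝ) ≤ n * T := by positivity
    have hlow : T * ρ ((n + 1) * T) ≤ ∫ x in (n * T : ℝ)..(n + 1) * T, ρ x := by
      have : ∫ x in (n * T : ℝ)..(n + 1) * T, ρ ((n + 1) * T) = T * ρ ((n + 1) * T) := by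
        rw [intervalIntegral.integral_const, smul_eq_mul]; ring
      rw [← this]
      refine intervalIntegral.integral_mono_on (by nlinarith)
        (Continuous.intervalIntegrable (by fun_prop) _ _) (hρ.intervalIntegrable _ _)
        fun x hx => hanti (hn.trans hx.1) ?_ hx.2
      exact hn.trans (hx.1.trans hx.2)
    have hsplit := intervalIntegral.integral_add_adjacent_intervals
      ((hf.mul hρ).intervalIntegrable (μ := volume) 0 ((n + 1) * T))
      ((hf.mul hρ).intervalIntegrable ((n + 1) * T) ((n + 1) * T + T))
    simp only [Pi.mul_apply] at hsplit
    have hsplit' := intervalIntegral.integral_add_adjacent_intervals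
      (hρ.intervalIntegrable (μ := volume) 0 (n * T))
      (hρ.intervalIntegrable (n * T) ((n + 1) * T))
    have hb := hblock ((n + 1) * T) (by positivity)
    push_cast
    rw [show ((n : ℝ) + 1 + 1) * T = (n + 1) * T + T by ring, ← hsplit, ← hsplit']
    have hlow' : ρ ((n + 1) * T) ≤ T⁻¹ * ∫ x in (n * T : ℝ)..(n + 1) * T, ρ x := by
      rw [inv_mul_eq_div, le_div_iff₀ hT]; linarith
    nlinarith [mul_le_mul_of_nonneg_left hlow' hI0]

lemma integral_exp_neg_one_sub_cos_gaussianReal_le {N : ℝ} (hN : 0 < N) {v : ℝ≥0} (hv : v ≠ 0) :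
    ∫ x, exp (-N * (1 - cos x)) ∂(gaussianReal 0 v) ≤
      2 * √(π ^ 3 / 2) * (1 / √v + 1) / √N := by
  set f : ℝ → ℝ := fun x => exp (-N * (1 - cos x)) with hf
  set ρ : ℝ → ℝ := gaussianPDFReal 0 v with hρ
  have hv' : (0 : ℝ) < v := by positivity
  have hfc : Continuous f := by fun_prop
  have hρc : Continuous ρ := by rw [hρ, gaussianPDFReal_def]; fun_prop
  have hρ0 : ∀ x, 0 ≤ ρ x := gaussianPDFReal_nonneg 0 v
  have hρi : Integrable ρ := integrable_gaussianPDFReal 0 v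
  have hf1 : ∀ x, f x ≤ 1 := fun x => by
    rw [hf]; simp only [exp_le_one_iff]; nlinarith [cos_le_one x]
  have hanti : AntitoneOn ρ (Ici 0) := fun x hx y _ hxy => by
    simp only [hρ, gaussianPDFReal_def, sub_zero]
    have : x ^ 2 ≤ y ^ 2 := pow_le_pow_left₀ hx hxy 2
    gcongr
  have hprod : Integrable (fun x => f x * ρ x) := by
    refine hρi.mono' (hfc.mul hρc).aestronglyMeasurable (ae_of_all _ fun x => ?_)
    rw [norm_of_nonneg (mul_nonneg (exp_pos _).le (hρ0 x))]
    exact mul_le_of_le_one_left (hρ0 x) (hf1 x)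
  have hρint : ∀ b : ℝ, 0 ≤ b → ∫ x in (0 : ℝ)..b, ρ x ≤ 1 := fun b hb => by
    rw [intervalIntegral.integral_of_le hb, ← integral_gaussianPDFReal_eq_one 0 hv]
    exact setIntegral_le_integral hρi (ae_of_all _ hρ0)
  have hI0 : 0 ≤ ∫ x in (0 : ℝ)..2 * π, f x :=
    intervalIntegral.integral_nonneg (by positivity) fun x _ => (exp_pos _).le
  have hhalf : ∫ x in Ioi (0 : ℝ), f x * ρ x ≤
      (∫ x in (0 : ℝ)..2 * π, f x) * (1 / √v + 1) := by
    have htend : Tendsto (fun n : ℕ => ((n : ℝ) + 1) * (2 * π)) atTop atTop :=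
      (tendsto_atTop_add_const_right _ _ tendsto_natCast_atTop_atTop).atTop_mul_const two_pi_pos
    refine le_of_tendsto (intervalIntegral_tendsto_integral_Ioi 0 hprod.integrableOn htend)
      (Eventually.of_forall fun n => ?_)
    refine (integral_periodic_mul_antitone_le two_pi_pos hfc (fun x => (exp_pos _).le)
      (fun x => by simp [hf]) hρc hanti n).trans (mul_le_mul_of_nonneg_left ?_ hI0)
    have h2π : 1 ≤ 2 * π := by linarith [two_le_pi]
    refine add_le_add ?_ ?_
    · simp only [hρ, gaussianPDFReal_def, sub_zero]
      simp only [ne_eq, OfNat.ofNat_ne_zero, not_false_eq_true, zero_pow, neg_zero, zero_div,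
        exp_zero, mul_one, one_div]
      gcongr
      nlinarith
    · exact mul_le_one₀ (inv_le_one_of_one_le₀ h2π)
        (intervalIntegral.integral_nonneg (by positivity) fun x _ => hρ0 x)
        (hρint _ (by positivity))
  have heven : ∫ x, f x * ρ x = 2 * ∫ x in Ioi (0 : ℝ), f x * ρ x := by
    rw [← integral_comp_abs (f := fun x => f x * ρ x)]
    refine integral_congr_ae (ae_of_all _ fun x => ?_)
    simp [hf, hρ, gaussianPDFReal_def]
  rw [integral_gaussianReal_eq_integral_smul hv]
  simp only [smul_eq_mul]
  rw [show (fun x => gaussianPDFReal 0 v x * exp (-N * (1 - cos x))) = fun x => f x * ρ x from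
    funext fun x => mul_comm _ _, heven]
  calc 2 * ∫ x in Ioi (0 : ℝ), f x * ρ x
      ≤ 2 * ((√(π ^ 3 / 2) / √N) * (1 / √v + 1)) := by
        gcongr
        exact hhalf.trans (mul_le_mul_of_nonneg_right (integral_exp_neg_one_sub_cos_le hN)
          (by positivity))
    _ = _ := by ring

section

variable {E : Type*} [NormedAddCommGroup E] [InnerProductSpace ℝ E] [FiniteDimensional ℝ E]
  [MeasurableSpace E] [BorelSpace E]

lemma map_inner_stdGaussian (y : E) :
    (stdGaussian E).map (fun g => ⟪y, g⟫) = gaussianReal 0 (‖y‖₊ ^ 2) := by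
  have h := IsGaussian.map_eq_gaussianReal (μ := stdGaussian E) (innerSL ℝ y)
  rw [integral_strongDual_stdGaussian, variance_dual_stdGaussian, innerSL_apply_norm] at h
  convert! h using 2
  rw [← NNReal.coe_inj]
  simp

lemma integral_exp_neg_one_sub_cos_inner_le {N : ℝ} (hN : 0 < N) {y : E} (hy : y ≠ 0) :
    ∫ g, exp (-N * (1 - cos ⟪y, g⟫)) ∂(stdGaussian E) ≤
      2 * √(π ^ 3 / 2) * (1 / ‖y‖ + 1) / √N := by
  have h := integral_exp_neg_one_sub_cos_gaussianReal_le hN (v := ‖y‖₊ ^ 2) (by simpa using hy)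
  rw [← map_inner_stdGaussian, integral_map (by fun_prop) (by fun_prop)] at h
  simpa using h

/-- Esseen-type smoothing inequality with Gaussian weight. -/
lemma measureReal_closedBall_le_integral_norm_charFun (μ : Measure E) [IsProbabilityMeasure μ]
    (x : E) {r : ℝ} (hr : 0 < r) :
    μ.real (Metric.closedBall x r) ≤
      exp (1 / 2) * ∫ g, ‖charFun μ (r⁻¹ • g)‖ ∂(stdGaussian E) := by
  have hgauss : ∀ z : E, ∫ g, Complex.exp (⟪g, z⟫ * Complex.I) ∂(stdGaussian E) =
      (exp (-‖z‖ ^ 2 / 2) : ℝ) := fun z => by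
    rw [← charFun_apply, charFun_stdGaussian]; push_cast; rfl
  have hint : Integrable (fun y => exp (-‖r⁻¹ • (y - x)‖ ^ 2 / 2)) μ := by
    refine Integrable.of_bound (C := 1) (by fun_prop) (ae_of_all _ fun y => ?_)
    rw [norm_of_nonneg (exp_pos _).le, exp_le_one_iff]
    have := sq_nonneg ‖r⁻¹ • (y - x)‖
    linarith
  have hball : μ.real (Metric.closedBall x r) ≤
      exp (1 / 2) * ∫ y, exp (-‖r⁻¹ • (y - x)‖ ^ 2 / 2) ∂μ := by
    rw [← integral_indicator_one measurableSet_closedBall, ← integral_const_mul]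
    refine integral_mono ((integrable_const (1 : ℝ)).indicator measurableSet_closedBall)
      (hint.const_mul _) fun y => ?_
    refine indicator_apply_le' (fun hy => ?_) fun _ => by positivity
    have hn : ‖r⁻¹ • (y - x)‖ ≤ 1 := by
      rw [norm_smul, norm_inv, norm_of_nonneg hr.le, inv_mul_le_one₀ hr, ← dist_eq_norm]
      exact hy
    rw [Pi.one_apply, ← exp_add, one_le_exp_iff]
    have := pow_le_one₀ (norm_nonneg _) hn (n := 2)
    linarith
  refine hball.trans (mul_le_mul_of_nonneg_left ?_ (exp_pos _).le)
  have hswap : ((∫ y, exp (-‖r⁻¹ • (y - x)‖ ^ 2 / 2) ∂μ : ℝ) : ℂ) =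
      ∫ g, Complex.exp (-(⟪g, r⁻¹ • x⟫ * Complex.I)) * charFun μ (r⁻¹ • g) ∂(stdGaussian E) := by
    rw [← integral_complex_ofReal]
    simp_rw [← hgauss]
    rw [integral_integral_swap]
    · refine integral_congr_ae (ae_of_all _ fun g => ?_)
      simp only [charFun_apply]
      rw [← integral_const_mul]
      refine integral_congr_ae (ae_of_all _ fun y => ?_)
      simp only
      rw [← Complex.exp_add, smul_sub, inner_sub_right, inner_smul_right g y, inner_smul_right y g,
        real_inner_comm]
      push_cast
      ring_nf
    · refine Integrable.of_bound (C := 1) ?_ (ae_of_all _ fun p => ?_)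
      · exact Continuous.aestronglyMeasurable (by unfold Function.uncurry; fun_prop)
      · simp [Function.uncurry, Complex.norm_exp_ofReal_mul_I]
  have hnn : 0 ≤ ∫ y, exp (-‖r⁻¹ • (y - x)‖ ^ 2 / 2) ∂μ := integral_nonneg fun y => (exp_pos _).le
  rw [← norm_of_nonneg hnn, ← Complex.norm_real, hswap]
  refine (norm_integral_le_integral_norm _).trans (le_of_eq ?_)
  refine integral_congr_ae (ae_of_all _ fun g => ?_)
  simp [Complex.norm_exp]

/-- Jensen's inequality combined with the one-dimensional Gaussian estimate. -/
lemma integral_exp_neg_integral_one_sub_cos_le (ν : Measure E) [IsProbabilityMeasure ν]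
    {N r s : ℝ} (hN : 0 < N) (hr : 0 < r) (hs : 0 < s) (hν : ∀ᵐ y ∂ν, s < ‖y‖) :
    ∫ g, exp (-N * ∫ y, (1 - cos ⟪y, r⁻¹ • g⟫) ∂ν) ∂(stdGaussian E) ≤
      2 * √(π ^ 3 / 2) * (r / s + 1) / √N := by
  have hle : ∀ z : ℝ, exp (-N * (1 - cos z)) ≤ 1 := fun z => by
    rw [exp_le_one_iff]; nlinarith [cos_le_one z]
  have hprod : Integrable (fun p : E × E => exp (-N * (1 - cos ⟪p.2, r⁻¹ • p.1⟫)))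
      ((stdGaussian E).prod ν) := by
    refine Integrable.of_bound (C := 1) ?_ (ae_of_all _ fun p => ?_)
    · exact Continuous.aestronglyMeasurable (by fun_prop)
    · rw [norm_of_nonneg (exp_pos _).le]; exact hle _
  have hcos : ∀ g : E, Integrable (fun y => 1 - cos ⟪y, r⁻¹ • g⟫) ν := fun g => by
    refine Integrable.of_bound (C := 2) (by fun_prop) (ae_of_all _ fun y => ?_)
    rw [norm_eq_abs, abs_le]
    constructor <;> linarith [cos_le_one ⟪y, r⁻¹ • g⟫, neg_one_le_cos ⟪y, r⁻¹ • g⟫]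
  have hjensen : ∀ g : E, exp (-N * ∫ y, (1 - cos ⟪y, r⁻¹ • g⟫) ∂ν) ≤
      ∫ y, exp (-N * (1 - cos ⟪y, r⁻¹ • g⟫)) ∂ν := fun g => by
    rw [← integral_const_mul]
    refine convexOn_exp.map_integral_le continuous_exp.continuousOn isClosed_univ (by simp)
      ((hcos g).const_mul _) ?_
    refine Integrable.of_bound (C := 1) ?_ (ae_of_all _ fun y => ?_)
    · exact Continuous.aestronglyMeasurable (by fun_prop)
    · simp only [Function.comp_apply, norm_of_nonneg (exp_pos _).le]; exact hle _
  calc ∫ g, exp (-N * ∫ y, (1 - cos ⟪y, r⁻¹ • g⟫) ∂ν) ∂(stdGaussian E)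
      ≤ ∫ g, ∫ y, exp (-N * (1 - cos ⟪y, r⁻¹ • g⟫)) ∂ν ∂(stdGaussian E) :=
        integral_mono_of_nonneg (ae_of_all _ fun g => (exp_pos _).le) hprod.integral_prod_left
          (ae_of_all _ hjensen)
    _ = ∫ y, ∫ g, exp (-N * (1 - cos ⟪y, r⁻¹ • g⟫)) ∂(stdGaussian E) ∂ν :=
        integral_integral_swap hprod
    _ ≤ ∫ _, 2 * √(π ^ 3 / 2) * (r / s + 1) / √N ∂ν := by
        refine integral_mono_ae hprod.integral_prod_right (integrable_const _) ?_
        filter_upwards [hν] with y hy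
        have hy0 : y ≠ 0 := norm_pos_iff.1 (hs.trans hy)
        have h := integral_exp_neg_one_sub_cos_inner_le hN
          (smul_ne_zero (inv_ne_zero hr.ne') hy0)
        simp_rw [inner_smul_left] at h
        simp_rw [inner_smul_right]
        refine h.trans ?_
        rw [norm_smul, norm_inv, norm_of_nonneg hr.le, one_div, mul_inv, inv_inv,
          ← div_eq_mul_inv]
        gcongr
    _ = _ := by simp

lemma integrable_exp_neg_sum_integral_one_sub_cos {ι : Type*} [Fintype ι] (ν : ι → Measure E)
    [∀ k, IsProbabilityMeasure (ν k)] {c : ℝ} (hc : 0 ≤ c) (r : ℝ) :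
    Integrable (fun g => exp (-c * ∑ k, ∫ y, (1 - cos ⟪y, r • g⟫) ∂(ν k))) (stdGaussian E) := by
  have hm : ∀ k, Measurable fun g : E => ∫ y, (1 - cos ⟪y, r • g⟫) ∂(ν k) := fun k => by
    have : StronglyMeasurable (Function.uncurry fun (g y : E) => 1 - cos ⟪y, r • g⟫) :=
      Continuous.stronglyMeasurable (by unfold Function.uncurry; fun_prop)
    exact this.integral_prod_right.measurable
  have hmeas := measurable_exp.comp
    ((Finset.measurable_sum Finset.univ fun k _ => hm k).const_mul (-c))
  refine Integrable.of_bound (C := 1) hmeas.aestronglyMeasurable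
    (ae_of_all _ fun g => ?_)
  rw [norm_of_nonneg (exp_pos _).le, exp_le_one_iff, neg_mul, neg_nonpos]
  exact mul_nonneg hc (Finset.sum_nonneg fun k _ => integral_nonneg fun y => by
    simp only [Pi.zero_apply]
    linarith [cos_le_one ⟪y, r • g⟫])

/-- A weighted version over several measures; the weights are `s k ^ 2 * (ν k) {s k < ‖y‖}`. -/
lemma integral_exp_neg_sum_le {ι : Type*} [Fintype ι] (ν : ι → Measure E)
    [∀ k, IsProbabilityMeasure (ν k)] {s : ι → ℝ} {r : ℝ} (hr : 0 < r) (hs : ∀ k, 0 < s k)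
    (hsr : ∀ k, s k ≤ r) (hD : 0 < ∑ k, s k ^ 2 * (ν k).real {y | s k < ‖y‖}) :
    ∫ g, exp (-(1 / 2) * ∑ k, ∫ y, (1 - cos ⟪y, r⁻¹ • g⟫) ∂(ν k)) ∂(stdGaussian E) ≤
      4 * √(π ^ 3) * r / √(∑ k, s k ^ 2 * (ν k).real {y | s k < ‖y‖}) := by
  set S : ι → Set E := fun k => {y | s k < ‖y‖} with hS
  have hSm : ∀ k, MeasurableSet (S k) := fun k => measurableSet_lt (by fun_prop) (by fun_prop)
  set D := ∑ k, s k ^ 2 * (ν k).real (S k) with hDdef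
  set w : ι → ℝ := fun k => s k ^ 2 * (ν k).real (S k) / D with hw
  have hw0 : ∀ k, 0 ≤ w k := fun k => by positivity
  have hw1 : ∑ k, w k = 1 := by rw [hw, ← Finset.sum_div, div_self hD.ne']
  set N : ι → ℝ := fun k => D / (2 * s k ^ 2) with hN
  have hN0 : ∀ k, 0 < N k := fun k => by have := hs k; positivity
  set A : ι → E → ℝ := fun k g => ∫ y, (1 - cos ⟪y, r⁻¹ • g⟫) ∂((ν k)[|S k]) with hA
  have hcos : ∀ (g : E) (y : E), 0 ≤ 1 - cos ⟪y, r⁻¹ • g⟫ := fun g y => by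
    linarith [cos_le_one ⟪y, r⁻¹ • g⟫]
  have hexp : ∀ k, Integrable (fun g => w k * exp (-N k * A k g)) (stdGaussian E) := fun k => by
    rcases eq_or_ne ((ν k) (S k)) 0 with h0 | h0
    · simp [hw, measureReal_def, h0]
    have := cond_isProbabilityMeasure h0
    simpa using (integrable_exp_neg_sum_integral_one_sub_cos (fun _ : Unit => (ν k)[|S k])
      (hN0 k).le r⁻¹).const_mul (w k)
  have hlower : ∀ k g, (ν k).real (S k) * A k g ≤
      ∫ y, (1 - cos ⟪y, r⁻¹ • g⟫) ∂(ν k) := fun k g => by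
    have hi : Integrable (fun y => 1 - cos ⟪y, r⁻¹ • g⟫) (ν k) := by
      refine Integrable.of_bound (C := 2) (by fun_prop) (ae_of_all _ fun y => ?_)
      rw [norm_of_nonneg (hcos g y)]
      linarith [neg_one_le_cos ⟪y, r⁻¹ • g⟫]
    refine le_trans ?_ (setIntegral_le_integral hi (ae_of_all _ (hcos g)) (s := S k))
    rcases eq_or_ne ((ν k).real (S k)) 0 with h0 | h0
    · rw [h0, zero_mul]; exact integral_nonneg (hcos g)
    · simp only [hA, ProbabilityTheory.cond, integral_smul_measure, smul_eq_mul, ENNReal.toReal_inv]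
      rw [← measureReal_def, ← mul_assoc, mul_inv_cancel₀ h0, one_mul]
  have hpoint : ∀ g, exp (-(1 / 2) * ∑ k, ∫ y, (1 - cos ⟪y, r⁻¹ • g⟫) ∂(ν k)) ≤
      ∑ k, w k * exp (-N k * A k g) := fun g => by
    refine le_trans ?_ (convexOn_exp.map_sum_le (fun k _ => hw0 k) hw1 fun k _ => mem_univ _)
    rw [exp_le_exp, Finset.mul_sum]
    refine Finset.sum_le_sum fun k _ => ?_
    have hk : w k • (-N k * A k g) = -(1 / 2) * ((ν k).real (S k) * A k g) := by
      have := hs k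
      simp only [hw, hN, smul_eq_mul]
      field_simp
    rw [hk]
    linarith [hlower k g]
  have hterm : ∀ k, w k * ∫ g, exp (-N k * A k g) ∂(stdGaussian E) ≤
      w k * (4 * √(π ^ 3) * r / √D) := fun k => by
    rcases eq_or_ne ((ν k) (S k)) 0 with h0 | h0
    · simp [hw, measureReal_def, h0]
    refine mul_le_mul_of_nonneg_left ?_ (hw0 k)
    have := cond_isProbabilityMeasure h0
    have hsk := hs k
    refine (integral_exp_neg_integral_one_sub_cos_le ((ν k)[|S k]) (hN0 k) hr hsk
      (ae_cond_mem (hSm k))).trans ?_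
    have h1 : r / s k + 1 ≤ 2 * r / s k := by
      have := (one_le_div hsk).2 (hsr k)
      rw [mul_div_assoc]; linarith
    have h2 : √(N k) = √D / (√2 * s k) := by
      rw [hN, sqrt_div hD.le, sqrt_mul zero_le_two, sqrt_sq hsk.le]
    calc 2 * √(π ^ 3 / 2) * (r / s k + 1) / √(N k)
        ≤ 2 * √(π ^ 3 / 2) * (2 * r / s k) / √(N k) := by gcongr
      _ = 4 * √(π ^ 3) * r / √D := by
        rw [h2, sqrt_div (by positivity)]
        have := sqrt_pos.2 hD
        field_simp
        norm_num
  calc ∫ g, exp (-(1 / 2) * ∑ k, ∫ y, (1 - cos ⟪y, r⁻¹ • g⟫) ∂(ν k)) ∂(stdGaussian E)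
      ≤ ∫ g, ∑ k, w k * exp (-N k * A k g) ∂(stdGaussian E) :=
        integral_mono_of_nonneg (ae_of_all _ fun g => (exp_pos _).le)
          (integrable_finsetSum _ fun k _ => hexp k) (ae_of_all _ hpoint)
    _ = ∑ k, w k * ∫ g, exp (-N k * A k g) ∂(stdGaussian E) := by
        rw [integral_finsetSum _ fun k _ => hexp k]
        simp_rw [integral_const_mul]
    _ ≤ ∑ k, w k * (4 * √(π ^ 3) * r / √D) := Finset.sum_le_sum fun k _ => hterm k
    _ = _ := by rw [← Finset.sum_mul, hw1, one_mul]

end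

variable {d : ℕ}

instance isProbabilityMeasure_symmLaw (μ : Measure (EuclideanSpace ℝ (Fin d)))
    [IsProbabilityMeasure μ] : IsProbabilityMeasure (symmLaw μ) :=
  Measure.isProbabilityMeasure_map (by fun_prop)

lemma normSq_charFun_eq_integral_symmLaw (μ : Measure (EuclideanSpace ℝ (Fin d)))
    [IsProbabilityMeasure μ] (t : EuclideanSpace ℝ (Fin d)) :
    ‖charFun μ t‖ ^ 2 = ∫ y, cos ⟪y, t⟫ ∂(symmLaw μ) := by
  have hsymm : charFun (symmLaw μ) t = charFun μ t * charFun μ (-t) := by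
    simp only [charFun_apply, symmLaw]
    rw [integral_map (by fun_prop) (by fun_prop), ← integral_prod_mul]
    refine integral_congr_ae (ae_of_all _ fun p => ?_)
    simp only
    rw [← Complex.exp_add, inner_sub_left, inner_neg_right]
    push_cast
    ring_nf
  have hint : Integrable (fun y => Complex.exp (⟪y, t⟫ * Complex.I)) (symmLaw μ) := by
    refine Integrable.of_bound (C := 1) (by fun_prop) (ae_of_all _ fun y => ?_)
    rw [Complex.norm_exp_ofReal_mul_I]
  have hre := congrArg Complex.re hsymm
  rw [charFun_neg, Complex.mul_conj, Complex.ofReal_re, Complex.normSq_eq_norm_sq] at hre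
  rw [← hre, charFun_apply]
  have := integral_re hint
  simp only [RCLike.re_to_complex] at this
  rw [← this]
  simp only [Complex.exp_ofReal_mul_I_re]

lemma norm_charFun_le_exp (μ : Measure (EuclideanSpace ℝ (Fin d)))
    [IsProbabilityMeasure μ] (t : EuclideanSpace ℝ (Fin d)) :
    ‖charFun μ t‖ ≤ exp (-(1 / 2) * ∫ y, (1 - cos ⟪y, t⟫) ∂(symmLaw μ)) := by
  have hint : Integrable (fun y => cos ⟪y, t⟫) (symmLaw μ) := by
    refine Integrable.of_bound (C := 1) (by fun_prop) (ae_of_all _ fun y => ?_)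
    exact abs_cos_le_one _
  rw [integral_sub (integrable_const _) hint, ← normSq_charFun_eq_integral_symmLaw]
  refine (sq_le_sq₀ (norm_nonneg _) (exp_pos _).le).1 ?_
  rw [← exp_nat_mul]
  have := add_one_le_exp (‖charFun μ t‖ ^ 2 - 1)
  simp only [integral_const, probReal_univ, smul_eq_mul, mul_one]
  convert! (show ‖charFun μ t‖ ^ 2 ≤ _ by linarith) using 2
  push_cast
  ring

lemma one_sub_concFn_le (μ : Measure (EuclideanSpace ℝ (Fin d))) [IsProbabilityMeasure μ] (r : ℝ) :
    1 - concFn μ r ≤ μ.real {y | r < ‖y‖} := by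
  have hbdd : BddAbove (range fun x => (μ (Metric.closedBall x r)).toReal) :=
    ⟨1, by rintro _ ⟨x, rfl⟩; exact measureReal_le_one⟩
  have h : μ.real (Metric.closedBall 0 r) ≤ concFn μ r := le_ciSup hbdd 0
  have hcompl : {y : EuclideanSpace ℝ (Fin d) | r < ‖y‖} = (Metric.closedBall 0 r)ᶜ := by
    ext y; simp
  rw [hcompl, probReal_compl_eq_one_sub measurableSet_closedBall]
  linarith

end

theorem stmt_7 :
    ∃ c : ℝ, 0 < c ∧
      ∀ (d n : ℕ) (F : Fin n → Measure (EuclideanSpace ℝ (Fin d))),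
      (∀ k, IsProbabilityMeasure (F k)) →
      ∀ (lamv : Fin n → ℝ) (lam : ℝ),
      (∀ k, 0 < lamv k) → 0 < lam → (∀ k, lamv k ≤ lam) →
      0 < ∑ k, lamv k ^ 2 * (1 - concFn (symmLaw (F k)) (lamv k)) →
      concFn ((Measure.pi F).map (fun ω => ∑ k, ω k)) lam ≤
        c * lam / Real.sqrt (∑ k, lamv k ^ 2 * (1 - concFn (symmLaw (F k)) (lamv k))) := by
  refine ⟨Real.exp (1 / 2) * (4 * √(Real.pi ^ 3)), by positivity, ?_⟩
  intro d n F hF lamv lam hlamv hlam hle hpos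
  have hmono : ∑ k, lamv k ^ 2 * (1 - concFn (symmLaw (F k)) (lamv k)) ≤
      ∑ k, lamv k ^ 2 * (symmLaw (F k)).real {y | lamv k < ‖y‖} :=
    Finset.sum_le_sum fun k _ =>
      mul_le_mul_of_nonneg_left (one_sub_concFn_le _ _) (sq_nonneg _)
  have : IsProbabilityMeasure ((Measure.pi F).map fun ω => ∑ k, ω k) :=
    Measure.isProbabilityMeasure_map (by fun_prop)
  refine ciSup_le fun x => ?_
  refine (measureReal_closedBall_le_integral_norm_charFun _ x hlam).trans ?_
  rw [mul_assoc, mul_div_assoc]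
  refine mul_le_mul_of_nonneg_left ?_ (Real.exp_pos _).le
  have hbound := integral_exp_neg_sum_le (fun k => symmLaw (F k)) hlam hlamv hle
    (hpos.trans_le hmono)
  refine le_trans ?_ (hbound.trans ?_)
  · refine integral_mono_of_nonneg (ae_of_all _ fun g => norm_nonneg _) ?_
      (ae_of_all _ fun g => ?_)
    · exact integrable_exp_neg_sum_integral_one_sub_cos _ (by norm_num) _
    · simp only
      rw [ProbabilityTheory.charFun_map_sum_pi_eq_prod, Finset.prod_apply, norm_prod,
        Finset.mul_sum, Real.exp_sum]
      exact Finset.prod_le_prod (fun k _ => norm_nonneg _) fun k _ => norm_charFun_le_exp _ _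
  · gcongr
end

section
/- Let X, X₁, …, Xₙ be i.i.d. real-valued random variables with Q(L(X), 1) ≤ 1 − p for some p > 0, and let a = (a₁, …, aₙ) with aₖ ∈ ℝ^d be such that 𝑁 = Σₖ aₖaₖᵀ is positive definite. Let 0 < D < d and α > 0, and suppose Σₖ(⟨t,aₖ⟩ − mₖ)² ≥ α² for all integers m₁, …, mₙ and all t ∈ ℝ^d with ‖t‖ ≤ D and maxₖ|⟨t,aₖ⟩| ≥ 1/2. Then there exist absolute constants c₁, c₂ > 0 such that Q(F_a, d/D) ≤ c₁^d ( exp(−c₂ p α²) + (√d/(√p D))^d (det 𝑁)^{-1/2} ). -/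
open MeasureTheory
open scoped RealInnerProductSpace

/-- Law of `S_a = ∑ k, X_k • a_k`, where `X_1, …, X_n` are i.i.d. with law `ν`. -/
noncomputable def sumLaw {d n : ℕ} (ν : Measure ℝ) (a : Fin n → EuclideanSpace ℝ (Fin d)) :
    Measure (EuclideanSpace ℝ (Fin d)) :=
  (Measure.pi fun _ : Fin n => ν).map (fun ω => ∑ k, ω k • a k)

/-- `M(τ) = E min(X̃²/τ², 1)`, where `X̃ = X₁ - X₂` with `X₁, X₂` i.i.d. of law `ν`. -/
noncomputable def Mfn (ν : Measure ℝ) (τ : ℝ) : ℝ :=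
  ∫ p : ℝ × ℝ, min ((p.1 - p.2) ^ 2 / τ ^ 2) 1 ∂(ν.prod ν)

/-- The matrix `𝑁 = ∑ k, aₖ aₖᵀ`. -/
noncomputable def covMat {d n : ℕ} (a : Fin n → EuclideanSpace ℝ (Fin d)) :
    Matrix (Fin d) (Fin d) ℝ :=
  Matrix.of fun i j => ∑ k, a k i * a k j

/-- One-dimensional concentration function `Q(ν, r) = sup_x ν [x - r, x + r]`. -/
noncomputable def concFn1 (ν : Measure ℝ) (r : ℝ) : ℝ :=
  ⨆ x : ℝ, (ν (Metric.closedBall x r)).toReal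

open Real in
/-- Esseen's smoothing inequality with a Gaussian kernel. -/
lemma measure_closedBall_le_integral_charFun {d : ℕ} (μ : Measure (EuclideanSpace ℝ (Fin d)))
    [IsProbabilityMeasure μ] {b : ℝ} (hb : 0 < b) (x : EuclideanSpace ℝ (Fin d)) {r : ℝ} :
    (μ (Metric.closedBall x r)).toReal ≤ exp (π ^ 2 / b * r ^ 2) * ((b / π) ^ ((d : ℝ) / 2) *
      ∫ t, exp (-b * ‖t‖ ^ 2) * ‖charFun μ ((2 * π) • t)‖) := by
  have hball : (μ (Metric.closedBall x r)).toReal ≤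
      ∫ y, exp (π ^ 2 / b * r ^ 2) * exp (-(π ^ 2 / b * ‖y - x‖ ^ 2)) ∂μ := by
    have h1 : (μ (Metric.closedBall x r)).toReal =
        ∫ y, (Metric.closedBall x r).indicator 1 y ∂μ := by
      rw [integral_indicator_one Metric.isClosed_closedBall.measurableSet]; rfl
    rw [h1]
    apply integral_mono_of_nonneg
    · exact Filter.Eventually.of_forall fun y => Set.indicator_nonneg (by simp) y
    · refine Integrable.const_mul ?_ _
      refine Integrable.of_bound (C := 1) (by fun_prop) (Filter.Eventually.of_forall fun y => ?_)
      rw [Real.norm_eq_abs, abs_of_pos (exp_pos _), exp_le_one_iff]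
      have : 0 ≤ π ^ 2 / b * ‖y - x‖ ^ 2 := by positivity
      linarith
    · refine Filter.Eventually.of_forall fun y => ?_
      by_cases hy : y ∈ Metric.closedBall x r
      · simp only [Set.indicator_of_mem hy, Pi.one_apply]
        rw [← exp_add]
        apply one_le_exp
        rw [Metric.mem_closedBall, dist_eq_norm] at hy
        have : ‖y - x‖ ^ 2 ≤ r ^ 2 := by gcongr
        have : π ^ 2 / b * ‖y - x‖ ^ 2 ≤ π ^ 2 / b * r ^ 2 := by gcongr
        linarith
      · simp only [Set.indicator_of_notMem hy]
        positivity
  rw [integral_const_mul] at hball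
  refine hball.trans (mul_le_mul_of_nonneg_left ?_ (exp_pos _).le)
  let F : EuclideanSpace ℝ (Fin d) → EuclideanSpace ℝ (Fin d) → ℂ := fun y t =>
    Complex.exp (-(b : ℂ) * (‖t‖ : ℂ) ^ 2 + (2 * π * Complex.I) * (⟪y - x, t⟫ : ℝ))
  have hFnorm : ∀ y t, ‖F y t‖ = exp (-b * ‖t‖ ^ 2) := by
    intro y t
    simp only [F, Complex.norm_exp]
    congr 1
    simp [← Complex.ofReal_pow, ← Complex.ofReal_mul]
  have hgauss : Integrable (fun t : EuclideanSpace ℝ (Fin d) => exp (-b * ‖t‖ ^ 2)) := by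
    have := (GaussianFourier.integrable_cexp_neg_mul_sq_norm_add (b := (b : ℂ))
      (by simpa using hb) 0 (0 : EuclideanSpace ℝ (Fin d))).norm
    refine this.congr (Filter.Eventually.of_forall fun t => ?_)
    simp [Complex.norm_exp, ← Complex.ofReal_pow]
  have hFint : Integrable (Function.uncurry F) (μ.prod volume) := by
    have h2 : Integrable (fun z : EuclideanSpace ℝ (Fin d) × EuclideanSpace ℝ (Fin d) =>
        exp (-b * ‖z.2‖ ^ 2)) (μ.prod volume) := hgauss.comp_snd μ
    refine h2.mono' ?_ (Filter.Eventually.of_forall fun z => (hFnorm z.1 z.2).le)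
    apply Continuous.aestronglyMeasurable
    simp only [F, Function.uncurry_def]
    fun_prop
  have hF1 : ∀ y, ∫ t, F y t =
      (((π / b) ^ ((d : ℝ) / 2) * exp (-(π ^ 2 / b * ‖y - x‖ ^ 2)) : ℝ) : ℂ) := by
    intro y
    simp only [F]
    rw [GaussianFourier.integral_cexp_neg_mul_sq_norm_add (by simpa using hb)]
    push_cast
    rw [Complex.ofReal_cpow (by positivity), finrank_euclideanSpace_fin]
    push_cast
    congr 2
    have : (b : ℂ) ≠ 0 := by exact_mod_cast hb.ne'
    rw [mul_pow, Complex.I_sq]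
    field_simp
    ring
  have hF2 : ∀ t, ‖∫ y, F y t ∂μ‖ = exp (-b * ‖t‖ ^ 2) * ‖charFun μ ((2 * π) • t)‖ := by
    intro t
    have : ∀ y, F y t = Complex.exp (-(b : ℂ) * (‖t‖ : ℂ) ^ 2 -
        (2 * π * Complex.I) * (⟪x, t⟫ : ℝ)) *
        Complex.exp ((⟪y, (2 * π) • t⟫ : ℝ) * Complex.I) := by
      intro y
      simp only [F]
      rw [← Complex.exp_add, inner_sub_left, inner_smul_right]
      congr 1
      push_cast
      ring
    simp_rw [this]
    rw [integral_const_mul, norm_mul, charFun_apply]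
    congr 1
    rw [Complex.norm_exp]
    congr 1
    simp [← Complex.ofReal_pow, ← Complex.ofReal_mul]
  have hswap := integral_integral_swap hFint
  simp_rw [hF1] at hswap
  rw [integral_complex_ofReal, integral_const_mul] at hswap
  have hle : (π / b) ^ ((d : ℝ) / 2) * ∫ y, exp (-(π ^ 2 / b * ‖y - x‖ ^ 2)) ∂μ ≤
      ∫ t, exp (-b * ‖t‖ ^ 2) * ‖charFun μ ((2 * π) • t)‖ := by
    refine (Complex.re_le_norm _).trans' (le_of_eq (Complex.ofReal_re _).symm) |>.trans ?_
    rw [hswap]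
    refine (norm_integral_le_integral_norm _).trans (le_of_eq ?_)
    simp_rw [hF2]
  have hcancel : (b / π) ^ ((d : ℝ) / 2) * (π / b) ^ ((d : ℝ) / 2) = 1 := by
    rw [← mul_rpow (by positivity) (by positivity)]
    have : b / π * (π / b) = 1 := by field_simp
    rw [this, one_rpow]
  calc ∫ y, exp (-(π ^ 2 / b * ‖y - x‖ ^ 2)) ∂μ
      = (b / π) ^ ((d : ℝ) / 2) * ((π / b) ^ ((d : ℝ) / 2) *
        ∫ y, exp (-(π ^ 2 / b * ‖y - x‖ ^ 2)) ∂μ) := by rw [← mul_assoc, hcancel, one_mul]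
    _ ≤ _ := by gcongr

/-- The `ℓ²` distance from the vector `(⟪t, a k⟫)ₖ` to the integer lattice. -/
noncomputable def latticeDist {d n : ℕ} (a : Fin n → EuclideanSpace ℝ (Fin d))
    (t : EuclideanSpace ℝ (Fin d)) : ℝ :=
  ‖(WithLp.toLp 2 fun k => ((⟪t, a k⟫ : ℝ) : UnitAddCircle) : PiLp 2 fun _ : Fin n => UnitAddCircle)‖

section latticeDist

variable {d n : ℕ} (a : Fin n → EuclideanSpace ℝ (Fin d))

lemma latticeDist_nonneg (t : EuclideanSpace ℝ (Fin d)) : 0 ≤ latticeDist a t := norm_nonneg _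

lemma latticeDist_sq_eq_sum_norm (t : EuclideanSpace ℝ (Fin d)) :
    latticeDist a t ^ 2 = ∑ k, ‖((⟪t, a k⟫ : ℝ) : UnitAddCircle)‖ ^ 2 := by
  rw [latticeDist, PiLp.norm_sq_eq_of_L2]

lemma latticeDist_sq (t : EuclideanSpace ℝ (Fin d)) :
    latticeDist a t ^ 2 = ∑ k, (⟪t, a k⟫ - round ⟪t, a k⟫) ^ 2 := by
  simp_rw [latticeDist_sq_eq_sum_norm, UnitAddCircle.norm_eq, sq_abs]

lemma latticeDist_sub_le (s t : EuclideanSpace ℝ (Fin d)) :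
    latticeDist a (s - t) ≤ latticeDist a s + latticeDist a t := by
  unfold latticeDist
  refine le_trans (le_of_eq ?_) (norm_sub_le _ _)
  congr 1
  ext k
  simp [inner_sub_left]

lemma continuous_latticeDist : Continuous (latticeDist a) := by
  unfold latticeDist
  refine continuous_norm.comp ((PiLp.continuous_toLp 2 _).comp (continuous_pi fun k => ?_))
  exact (AddCircle.continuous_mk' 1).comp (by fun_prop)

lemma latticeDist_sq_le (t : EuclideanSpace ℝ (Fin d)) : latticeDist a t ^ 2 ≤ n := by
  rw [latticeDist_sq]
  calc ∑ k, (⟪t, a k⟫ - round ⟪t, a k⟫) ^ 2 ≤ ∑ _k : Fin n, (1 : ℝ) := by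
        refine Finset.sum_le_sum fun k _ => ?_
        have := abs_sub_round (⟪t, a k⟫ : ℝ)
        rw [abs_le] at this
        nlinarith
    _ = n := by simp

lemma latticeDist_sq_of_forall_lt {t : EuclideanSpace ℝ (Fin d)}
    (ht : ∀ k, |(⟪t, a k⟫ : ℝ)| < 1 / 2) : latticeDist a t ^ 2 = ∑ k, ⟪t, a k⟫ ^ 2 := by
  rw [latticeDist_sq]
  refine Finset.sum_congr rfl fun k _ => ?_
  have h := abs_lt.mp (ht k)
  rw [round_eq_zero_iff.mpr ⟨h.1.le, h.2⟩]
  simp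

end latticeDist

open Real in
lemma norm_charFun_le_exp_s9 (ν : Measure ℝ) [IsProbabilityMeasure ν] (s : ℝ) :
    ‖charFun ν s‖ ≤ exp (-(1 / 2) * ∫ z : ℝ × ℝ, (1 - cos (s * (z.1 - z.2))) ∂(ν.prod ν)) := by
  have hcos : Integrable (fun z : ℝ × ℝ => cos (s * (z.1 - z.2))) (ν.prod ν) :=
    Integrable.of_bound (C := 1) (by fun_prop)
      (Filter.Eventually.of_forall fun z => abs_cos_le_one _)
  have hsq : ‖charFun ν s‖ ^ 2 = ∫ z : ℝ × ℝ, cos (s * (z.1 - z.2)) ∂(ν.prod ν) := by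
    have h1 : ((‖charFun ν s‖ ^ 2 : ℝ) : ℂ) =
        ∫ z : ℝ × ℝ, Complex.exp ((s * (z.1 - z.2) : ℝ) * Complex.I) ∂(ν.prod ν) := by
      rw [← Complex.normSq_eq_norm_sq, ← Complex.mul_conj, charFun_apply_real, ← integral_conj,
        ← integral_prod_mul]
      congr 1
      ext z
      rw [← Complex.exp_conj, ← Complex.exp_add]
      congr 1
      simp
      ring
    rw [← Complex.ofReal_re (‖charFun ν s‖ ^ 2), h1]
    rw [← RCLike.re_to_complex, ← integral_re]
    · simp only [RCLike.re_to_complex, Complex.exp_ofReal_mul_I_re]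
    · refine Integrable.of_bound (C := 1) (by fun_prop) (Filter.Eventually.of_forall fun z => ?_)
      rw [Complex.norm_exp_ofReal_mul_I]
  rw [integral_sub (integrable_const _) hcos, ← hsq]
  simp only [integral_const, probReal_univ, smul_eq_mul, mul_one]
  have h2 : ‖charFun ν s‖ ^ 2 ≤ exp (-(1 / 2) * (1 - ‖charFun ν s‖ ^ 2)) ^ 2 := by
    rw [← exp_nat_mul]
    have := add_one_le_exp (((2 : ℕ) : ℝ) * (-(1 / 2) * (1 - ‖charFun ν s‖ ^ 2)))
    push_cast at this ⊢
    linarith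
  exact le_of_sq_le_sq h2 (exp_pos _).le

open Real in
lemma norm_sq_le_one_sub_cos (w : ℝ) : 8 * ‖(w : UnitAddCircle)‖ ^ 2 ≤ 1 - cos (2 * π * w) := by
  rw [UnitAddCircle.norm_eq, sq_abs]
  set v := w - round w with hv
  have hcos : cos (2 * π * w) = cos (2 * π * v) := by
    rw [hv, ← cos_sub_int_mul_two_pi (2 * π * w) (round w)]
    ring_nf
  have hvb : |2 * π * v| ≤ π := by
    rw [abs_mul, abs_of_pos (by positivity)]
    have := abs_sub_round w
    nlinarith [pi_pos]
  have h := cos_le_one_sub_mul_cos_sq hvb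
  have h3 : 2 / π ^ 2 * (2 * π * v) ^ 2 = 8 * v ^ 2 := by
    field_simp
    ring
  rw [hcos]
  linarith

open Real in
lemma norm_charFun_sumLaw_le {d n : ℕ} (ν : Measure ℝ) [IsProbabilityMeasure ν]
    (a : Fin n → EuclideanSpace ℝ (Fin d)) (t : EuclideanSpace ℝ (Fin d)) :
    ‖charFun (sumLaw ν a) ((2 * π) • t)‖ ≤
      exp (-4 * ∫ z : ℝ × ℝ, latticeDist a ((z.1 - z.2) • t) ^ 2 ∂(ν.prod ν)) := by
  have hprod : charFun (sumLaw ν a) ((2 * π) • t) = ∏ k, charFun ν (2 * π * ⟪t, a k⟫) := by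
    rw [charFun_apply, sumLaw, integral_map (Continuous.measurable (by fun_prop)).aemeasurable
      (by fun_prop)]
    simp_rw [charFun_apply_real]
    rw [← integral_fintype_prod_eq_prod]
    congr 1
    ext ω
    rw [← Complex.exp_sum, sum_inner, Complex.ofReal_sum, Finset.sum_mul]
    congr 1
    refine Finset.sum_congr rfl fun k _ => ?_
    rw [inner_smul_left, inner_smul_right, real_inner_comm]
    simp
    ring
  have hint : ∀ k, Integrable (fun z : ℝ × ℝ =>
      1 - cos (2 * π * ⟪t, a k⟫ * (z.1 - z.2))) (ν.prod ν) := fun k =>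
    Integrable.of_bound (C := 2) (by fun_prop) (Filter.Eventually.of_forall fun z => by
      rw [Real.norm_eq_abs, abs_le]
      constructor <;> linarith [cos_le_one (2 * π * ⟪t, a k⟫ * (z.1 - z.2)),
        neg_one_le_cos (2 * π * ⟪t, a k⟫ * (z.1 - z.2))])
  rw [hprod, norm_prod]
  calc ∏ k, ‖charFun ν (2 * π * ⟪t, a k⟫)‖
      ≤ ∏ k, exp (-(1 / 2) *
          ∫ z : ℝ × ℝ, (1 - cos (2 * π * ⟪t, a k⟫ * (z.1 - z.2))) ∂(ν.prod ν)) :=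
        Finset.prod_le_prod (fun k _ => norm_nonneg _) fun k _ => norm_charFun_le_exp_s9 ν _
    _ = exp (-(1 / 2) *
          ∫ z : ℝ × ℝ, ∑ k, (1 - cos (2 * π * ⟪t, a k⟫ * (z.1 - z.2))) ∂(ν.prod ν)) := by
        rw [← exp_sum, integral_finsetSum _ fun k _ => hint k, Finset.mul_sum]
    _ ≤ _ := by
        apply exp_le_exp.mpr
        have : ∫ z : ℝ × ℝ, 8 * latticeDist a ((z.1 - z.2) • t) ^ 2 ∂(ν.prod ν) ≤
            ∫ z : ℝ × ℝ, ∑ k, (1 - cos (2 * π * ⟪t, a k⟫ * (z.1 - z.2))) ∂(ν.prod ν) := by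
          apply integral_mono_of_nonneg
          · exact Filter.Eventually.of_forall fun z => by positivity
          · exact integrable_finsetSum _ fun k _ => hint k
          · refine Filter.Eventually.of_forall fun z => ?_
            simp only [latticeDist_sq_eq_sum_norm, Finset.mul_sum]
            refine Finset.sum_le_sum fun k _ => ?_
            refine (norm_sq_le_one_sub_cos _).trans (le_of_eq ?_)
            rw [inner_smul_left]
            simp only [conj_trivial]
            ring_nf
        rw [integral_const_mul] at this
        linarith

open ProbabilityTheory in
/-- The symmetrization of `ν`, conditioned on `|x - y| > 1`, together with Jensen's inequality. -/
lemma exists_conditioned_symmetrization (ν : Measure ℝ) [IsProbabilityMeasure ν] {p : ℝ}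
    (hp : 0 < p) (hν : concFn1 ν 1 ≤ 1 - p) :
    ∃ m : Measure (ℝ × ℝ), IsProbabilityMeasure m ∧ (∀ᵐ z ∂m, 1 < |z.1 - z.2|) ∧
      ∀ g : ℝ × ℝ → ℝ, Measurable g → (∀ z, 0 ≤ g z) → ∀ C : ℝ, (∀ z, g z ≤ C) →
        Real.exp (-4 * ∫ z, g z ∂(ν.prod ν)) ≤ ∫ z, Real.exp (-4 * p * g z) ∂m := by
  set Z : Set (ℝ × ℝ) := {z | 1 < |z.1 - z.2|} with hZ
  have hZm : MeasurableSet Z := measurableSet_lt measurable_const (by fun_prop)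
  have hball : ∀ y, ν (Metric.closedBall y 1) ≤ ENNReal.ofReal (1 - p) := by
    intro y
    rw [← ENNReal.ofReal_toReal (measure_ne_top ν (Metric.closedBall y 1))]
    apply ENNReal.ofReal_le_ofReal
    refine (le_ciSup (f := fun x : ℝ => (ν (Metric.closedBall x 1)).toReal) ⟨1, ?_⟩ y).trans hν
    rintro _ ⟨x, rfl⟩
    exact measureReal_le_one
  have hp1 : p ≤ 1 := by
    have : 0 ≤ concFn1 ν 1 := Real.iSup_nonneg fun _ => ENNReal.toReal_nonneg
    linarith
  have hcompl : (ν.prod ν) Zᶜ ≤ ENNReal.ofReal (1 - p) := by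
    rw [Measure.prod_apply hZm.compl]
    calc ∫⁻ x, ν (Prod.mk x ⁻¹' Zᶜ) ∂ν ≤ ∫⁻ _x, ENNReal.ofReal (1 - p) ∂ν := by
          refine lintegral_mono fun x => (measure_mono ?_).trans (hball x)
          intro y hy
          simp only [hZ, Set.mem_preimage, Set.mem_compl_iff, Set.mem_ofPred_eq, not_lt] at hy
          rwa [Metric.mem_closedBall, Real.dist_eq, abs_sub_comm]
      _ = ENNReal.ofReal (1 - p) := by simp
  have hq : p ≤ (ν.prod ν).real Z := by
    have h1 : (ν.prod ν).real Zᶜ ≤ 1 - p :=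
      ENNReal.toReal_le_of_le_ofReal (by linarith) hcompl
    rw [probReal_compl_eq_one_sub hZm] at h1
    linarith
  have hZ0 : (ν.prod ν) Z ≠ 0 := by
    intro h
    rw [measureReal_def, h] at hq
    simp at hq
    linarith
  have hprob : IsProbabilityMeasure (cond (ν.prod ν) Z) := cond_isProbabilityMeasure hZ0
  refine ⟨cond (ν.prod ν) Z, hprob, ae_cond_mem hZm, fun g hg hg0 C hC => ?_⟩
  have hgint : ∀ (m : Measure (ℝ × ℝ)) [IsFiniteMeasure m], Integrable g m := fun m _ =>
    Integrable.of_bound (C := C) hg.aestronglyMeasurable (Filter.Eventually.of_forall fun z => by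
      rw [Real.norm_eq_abs, abs_of_nonneg (hg0 z)]
      exact hC z)
  have hcondint : ∫ z, g z ∂(cond (ν.prod ν) Z) =
      ((ν.prod ν).real Z)⁻¹ * ∫ z in Z, g z ∂(ν.prod ν) := by
    rw [ProbabilityTheory.cond, integral_smul_measure, ENNReal.toReal_inv]
    rfl
  have hle : p * ∫ z, g z ∂(cond (ν.prod ν) Z) ≤ ∫ z, g z ∂(ν.prod ν) := by
    calc p * ∫ z, g z ∂(cond (ν.prod ν) Z)
        ≤ (ν.prod ν).real Z * ∫ z, g z ∂(cond (ν.prod ν) Z) :=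
          mul_le_mul_of_nonneg_right hq (integral_nonneg hg0)
      _ = ∫ z in Z, g z ∂(ν.prod ν) := by
          rw [hcondint, ← mul_assoc, mul_inv_cancel₀ (hp.trans_le hq).ne', one_mul]
      _ ≤ ∫ z, g z ∂(ν.prod ν) :=
          setIntegral_le_integral (hgint _) (Filter.Eventually.of_forall hg0)
  calc Real.exp (-4 * ∫ z, g z ∂(ν.prod ν))
      ≤ Real.exp (∫ z, -4 * p * g z ∂(cond (ν.prod ν) Z)) := by
        rw [integral_const_mul]
        apply Real.exp_le_exp.mpr
        linarith
    _ ≤ _ := by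
        refine convexOn_exp.map_integral_le Real.continuous_exp.continuousOn isClosed_univ
          (by simp) ((hgint _).const_mul _) ?_
        refine Integrable.of_bound (C := 1) (by fun_prop) (Filter.Eventually.of_forall fun z => ?_)
        rw [Function.comp_apply, Real.norm_eq_abs, abs_of_pos (Real.exp_pos _),
          Real.exp_le_one_iff]
        have := mul_nonneg hp.le (hg0 z)
        linarith

lemma lintegral_exp_neg_mul_sq_norm {d : ℕ} {b : ℝ} (hb : 0 < b) :
    ∫⁻ t : EuclideanSpace ℝ (Fin d), ENNReal.ofReal (Real.exp (-b * ‖t‖ ^ 2)) =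
      ENNReal.ofReal ((Real.pi / b) ^ ((d : ℝ) / 2)) := by
  have h := GaussianFourier.integral_rexp_neg_mul_sq_norm (V := EuclideanSpace ℝ (Fin d)) hb
  rw [finrank_euclideanSpace_fin] at h
  rw [← h, ofReal_integral_eq_lintegral_ofReal]
  · by_contra hni
    rw [integral_undef hni] at h
    have : 0 < (Real.pi / b) ^ ((d : ℝ) / 2) := by positivity
    linarith
  · exact Filter.Eventually.of_forall fun t => (Real.exp_pos _).le

open scoped ComplexOrder MatrixOrder Matrix.Norms.L2Operator in
lemma exists_sum_inner_sq_eq_norm_sq {d n : ℕ} {a : Fin n → EuclideanSpace ℝ (Fin d)}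
    (ha : (covMat a).PosDef) :
    ∃ f : EuclideanSpace ℝ (Fin d) →ₗ[ℝ] EuclideanSpace ℝ (Fin d),
      |LinearMap.det f| = Real.sqrt (covMat a).det ∧
      ∀ t, ∑ k, ⟪t, a k⟫ ^ 2 = ‖f t‖ ^ 2 := by
  obtain ⟨B, hB⟩ := CStarAlgebra.nonneg_iff_eq_star_mul_self.mp ha.posSemidef.nonneg
  rw [Matrix.star_eq_conjTranspose, Matrix.conjTranspose_eq_transpose_of_trivial] at hB
  refine ⟨Matrix.toLpLin 2 2 B, ?_, fun t => ?_⟩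
  · rw [LinearMap.det_toLpLin, hB, Matrix.det_mul, Matrix.det_transpose,
      Real.sqrt_mul_self_eq_abs]
  · have h1 : ‖Matrix.toLpLin 2 2 B t‖ ^ 2 = t.ofLp ⬝ᵥ (covMat a).mulVec t.ofLp := by
      rw [EuclideanSpace.real_norm_sq_eq, hB, ← Matrix.mulVec_mulVec, Matrix.dotProduct_mulVec,
        Matrix.vecMul_transpose]
      simp [dotProduct, Matrix.toLpLin_apply, sq]
    rw [h1]
    simp only [covMat, dotProduct, Matrix.mulVec, Matrix.of_apply, PiLp.inner_apply,
      RCLike.inner_apply, conj_trivial, sq, Finset.mul_sum, Finset.sum_mul]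
    rw [Finset.sum_comm]
    refine Finset.sum_congr rfl fun i _ => ?_
    rw [Finset.sum_comm]
    refine Finset.sum_congr rfl fun j _ => Finset.sum_congr rfl fun k _ => ?_
    ring

lemma lintegral_exp_neg_mul_sum_inner_sq {d n : ℕ} {a : Fin n → EuclideanSpace ℝ (Fin d)}
    (ha : (covMat a).PosDef) {p : ℝ} (hp : 0 < p) :
    ∫⁻ t : EuclideanSpace ℝ (Fin d), ENNReal.ofReal (Real.exp (-p * ∑ k, ⟪t, a k⟫ ^ 2)) =
      ENNReal.ofReal ((Real.pi / p) ^ ((d : ℝ) / 2) * (1 / Real.sqrt (covMat a).det)) := by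
  obtain ⟨f, hdet, hf⟩ := exists_sum_inner_sq_eq_norm_sq ha
  have hdet0 : LinearMap.det f ≠ 0 := by
    rw [← abs_pos, hdet]
    exact Real.sqrt_pos.mpr ha.det_pos
  simp_rw [hf]
  rw [← lintegral_map (f := fun u => ENNReal.ofReal (Real.exp (-p * ‖u‖ ^ 2))) (by fun_prop)
      (LinearMap.continuous_of_finiteDimensional f).measurable,
    Measure.map_linearMap_addHaar_eq_smul_addHaar _ hdet0, lintegral_smul_measure,
    lintegral_exp_neg_mul_sq_norm hp, abs_inv, hdet, smul_eq_mul,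
    ← ENNReal.ofReal_mul (by positivity), mul_comm, one_div]

/-- The part of `exp (-4 p f²)` carried by the sublevel set `f < α / 2` of `f = latticeDist a`. -/
noncomputable def nearLattice {d n : ℕ} (a : Fin n → EuclideanSpace ℝ (Fin d)) (p α : ℝ)
    (t : EuclideanSpace ℝ (Fin d)) : ENNReal :=
  {t | latticeDist a t < α / 2}.indicator
    (fun t => ENNReal.ofReal (Real.exp (-4 * p * latticeDist a t ^ 2))) t

lemma measurable_nearLattice {d n : ℕ} (a : Fin n → EuclideanSpace ℝ (Fin d)) (p α : ℝ) :
    Measurable (nearLattice a p α) := by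
  have := continuous_latticeDist a
  exact Measurable.indicator (by fun_prop) (measurableSet_lt (by fun_prop) (by fun_prop))

/-- Differences of points of a sublevel set in a ball of radius `D / 2` see the lattice
distance as a quadratic form, so the integral is dominated by a Gaussian one. -/
lemma setLIntegral_nearLattice_le {d n : ℕ} {a : Fin n → EuclideanSpace ℝ (Fin d)}
    (ha : (covMat a).PosDef) {p α D : ℝ} (hp : 0 < p) (hα : 0 < α) (hD : 0 < D)
    (hlcd : ∀ (m : Fin n → ℤ) (t : EuclideanSpace ℝ (Fin d)),
        ‖t‖ ≤ D → (∃ k, (1 / 2 : ℝ) ≤ |⟪t, a k⟫|) →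
        α ^ 2 ≤ ∑ k, (⟪t, a k⟫ - m k) ^ 2) (x : EuclideanSpace ℝ (Fin d)) :
    ∫⁻ t in Metric.closedBall x (D / 2), nearLattice a p α t ≤
      ENNReal.ofReal ((Real.pi / p) ^ ((d : ℝ) / 2) * (1 / Real.sqrt (covMat a).det)) := by
  have hball := (Metric.isClosed_closedBall (x := x) (ε := D / 2)).measurableSet
  obtain ⟨s, hs, hmin⟩ := (isCompact_closedBall x (D / 2)).exists_isMinOn
    (Metric.nonempty_closedBall.mpr (by positivity)) (continuous_latticeDist a).continuousOn
  have key : ∀ t ∈ Metric.closedBall x (D / 2), nearLattice a p α t ≤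
      ENNReal.ofReal (Real.exp (-p * ∑ k, ⟪t - s, a k⟫ ^ 2)) := by
    intro t ht
    by_cases htE : latticeDist a t < α / 2
    · rw [nearLattice, Set.indicator_of_mem (by exact htE)]
      apply ENNReal.ofReal_le_ofReal
      apply Real.exp_le_exp.mpr
      have hst : latticeDist a s ≤ latticeDist a t := hmin ht
      have htri := latticeDist_sub_le a t s
      have h0 := latticeDist_nonneg a (t - s)
      have hsmall : ∀ k, |(⟪t - s, a k⟫ : ℝ)| < 1 / 2 := by
        by_contra! hk
        have hnorm : ‖t - s‖ ≤ D := by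
          rw [← dist_eq_norm]
          linarith [dist_triangle_right t s x, Metric.mem_closedBall.mp ht,
            Metric.mem_closedBall.mp hs]
        have := hlcd (fun k => round ⟪t - s, a k⟫) (t - s) hnorm hk
        rw [← latticeDist_sq] at this
        nlinarith
      rw [← latticeDist_sq_of_forall_lt a hsmall]
      have : latticeDist a (t - s) ^ 2 ≤ 4 * latticeDist a t ^ 2 := by nlinarith
      nlinarith
    · rw [nearLattice, Set.indicator_of_notMem (by exact htE)]
      exact zero_le
  calc ∫⁻ t in Metric.closedBall x (D / 2), nearLattice a p α t
      ≤ ∫⁻ t in Metric.closedBall x (D / 2),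
          ENNReal.ofReal (Real.exp (-p * ∑ k, ⟪t - s, a k⟫ ^ 2)) := setLIntegral_mono' hball key
    _ ≤ ∫⁻ t, ENNReal.ofReal (Real.exp (-p * ∑ k, ⟪t - s, a k⟫ ^ 2)) :=
        setLIntegral_le_lintegral _ _
    _ = _ := by
        rw [lintegral_sub_right_eq_self
          (fun t => ENNReal.ofReal (Real.exp (-p * ∑ k, ⟪t, a k⟫ ^ 2))) s,
          lintegral_exp_neg_mul_sum_inner_sq ha hp]

/-- A function with uniformly bounded integrals over balls of radius `R` is integrated against
a Gaussian density as if it were smoothed at scale `R`. -/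
lemma volume_closedBall_mul_lintegral_gaussian_le {d : ℕ} {h : EuclideanSpace ℝ (Fin d) → ENNReal}
    (hh : Measurable h) {b R : ℝ} (hb : 0 < b) {H : ENNReal}
    (hH : ∀ x, ∫⁻ t in Metric.closedBall x R, h t ≤ H) :
    volume (Metric.closedBall (0 : EuclideanSpace ℝ (Fin d)) R) *
        ∫⁻ t, ENNReal.ofReal (Real.exp (-b * ‖t‖ ^ 2)) * h t ≤
      ENNReal.ofReal (Real.exp (b * R ^ 2)) *
        ENNReal.ofReal ((2 * Real.pi / b) ^ ((d : ℝ) / 2)) * H := by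
  let S : Set (EuclideanSpace ℝ (Fin d) × EuclideanSpace ℝ (Fin d)) := {z | dist z.1 z.2 ≤ R}
  have hS : MeasurableSet S := measurableSet_le (by fun_prop) (by fun_prop)
  let G : EuclideanSpace ℝ (Fin d) → EuclideanSpace ℝ (Fin d) → ENNReal := fun t x =>
    S.indicator (fun z => ENNReal.ofReal (Real.exp (-b * ‖z.1‖ ^ 2)) * h z.1) (t, x)
  have hG : Measurable (Function.uncurry G) :=
    Measurable.indicator (by fun_prop) hS
  have hleft : ∀ t, ∫⁻ x, G t x = volume (Metric.closedBall (0 : EuclideanSpace ℝ (Fin d)) R) *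
      (ENNReal.ofReal (Real.exp (-b * ‖t‖ ^ 2)) * h t) := by
    intro t
    have : ∀ x, G t x = (Metric.closedBall t R).indicator
        (fun _ => ENNReal.ofReal (Real.exp (-b * ‖t‖ ^ 2)) * h t) x := by
      intro x
      simp only [G, S, Set.indicator, Set.mem_ofPred_eq, Metric.mem_closedBall, dist_comm x t]
    simp_rw [this]
    rw [lintegral_indicator_const Metric.isClosed_closedBall.measurableSet,
      Measure.addHaar_closedBall_center, mul_comm]
  have hright : ∀ x, ∫⁻ t, G t x ≤ ENNReal.ofReal (Real.exp (b * R ^ 2)) *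
      ENNReal.ofReal (Real.exp (-(b / 2) * ‖x‖ ^ 2)) * H := by
    intro x
    have hGle : ∀ t, G t x ≤ (Metric.closedBall x R).indicator (fun t =>
        ENNReal.ofReal (Real.exp (b * R ^ 2)) *
          ENNReal.ofReal (Real.exp (-(b / 2) * ‖x‖ ^ 2)) * h t) t := by
      intro t
      by_cases ht : dist t x ≤ R
      · rw [Set.indicator_of_mem (by exact ht)]
        simp only [G]
        rw [Set.indicator_of_mem (by exact ht), ← ENNReal.ofReal_mul (Real.exp_pos _).le,
          ← Real.exp_add]
        gcongr
        have h1 : ‖x‖ ≤ ‖t‖ + dist t x := by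
          rw [dist_comm, dist_eq_norm]
          simpa using norm_add_le t (x - t)
        have h2 : ‖x‖ ^ 2 ≤ 2 * ‖t‖ ^ 2 + 2 * R ^ 2 := by
          have h3 : ‖x‖ ≤ ‖t‖ + R := h1.trans (by gcongr)
          nlinarith [norm_nonneg x, sq_nonneg (‖t‖ - R)]
        nlinarith
      · simp only [G]
        rw [Set.indicator_of_notMem (by exact ht)]
        exact zero_le
    calc ∫⁻ t, G t x ≤ _ := lintegral_mono hGle
      _ = ENNReal.ofReal (Real.exp (b * R ^ 2)) *
          ENNReal.ofReal (Real.exp (-(b / 2) * ‖x‖ ^ 2)) *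
            ∫⁻ t in Metric.closedBall x R, h t := by
          rw [lintegral_indicator Metric.isClosed_closedBall.measurableSet,
            lintegral_const_mul _ hh]
      _ ≤ _ := by gcongr; exact hH x
  calc _ = ∫⁻ t, ∫⁻ x, G t x := by
        simp_rw [hleft]
        rw [lintegral_const_mul _ (by fun_prop)]
    _ = ∫⁻ x, ∫⁻ t, G t x := lintegral_lintegral_swap hG.aemeasurable
    _ ≤ ∫⁻ x, ENNReal.ofReal (Real.exp (b * R ^ 2)) *
          ENNReal.ofReal (Real.exp (-(b / 2) * ‖x‖ ^ 2)) * H := lintegral_mono hright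
    _ = _ := by
        rw [lintegral_mul_const _ (by fun_prop), lintegral_const_mul _ (by fun_prop),
          lintegral_exp_neg_mul_sq_norm (by positivity)]
        congr 4
        field_simp

lemma ofReal_pow_le_volume_closedBall {d : ℕ} (hd : 0 < d) {R : ℝ} (hR : 0 ≤ R) :
    ENNReal.ofReal ((2 * R / Real.sqrt d) ^ d) ≤
      volume (Metric.closedBall (0 : EuclideanSpace ℝ (Fin d)) R) := by
  have hd' : (0 : ℝ) < d := by exact_mod_cast hd
  have h1 : volume (Metric.closedBall (0 : Fin d → ℝ) (R / Real.sqrt d)) =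
      ENNReal.ofReal ((2 * R / Real.sqrt d) ^ d) := by
    rw [Real.volume_pi_closedBall _ (by positivity), Fintype.card_fin, mul_div_assoc]
  rw [← h1, ← (PiLp.volume_preserving_ofLp (Fin d)).measure_preimage
    Metric.isClosed_closedBall.measurableSet.nullMeasurableSet]
  refine measure_mono fun t ht => ?_
  rw [Set.mem_preimage, mem_closedBall_zero_iff, pi_norm_le_iff_of_nonneg (by positivity)] at ht
  rw [mem_closedBall_zero_iff]
  refine le_of_sq_le_sq ?_ hR
  rw [EuclideanSpace.norm_sq_eq]
  calc ∑ i, ‖t i‖ ^ 2 ≤ ∑ _i : Fin d, (R / Real.sqrt d) ^ 2 := by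
        gcongr with i
        exact ht i
    _ = R ^ 2 := by
        rw [Finset.sum_const, Finset.card_univ, Fintype.card_fin, nsmul_eq_mul, div_pow,
          Real.sq_sqrt hd'.le]
        field_simp

lemma integrable_exp_neg_mul_sq_norm {d : ℕ} {b : ℝ} (hb : 0 < b) :
    Integrable (fun t : EuclideanSpace ℝ (Fin d) => Real.exp (-b * ‖t‖ ^ 2)) := by
  refine ⟨by fun_prop, ?_⟩
  rw [hasFiniteIntegral_iff_ofReal (Filter.Eventually.of_forall fun t => (Real.exp_pos _).le),
    lintegral_exp_neg_mul_sq_norm hb]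
  exact ENNReal.ofReal_lt_top

lemma exp_neg_mul_latticeDist_sq_le {d n : ℕ} (a : Fin n → EuclideanSpace ℝ (Fin d)) {p α : ℝ}
    (hp : 0 < p) (hα : 0 < α) (t : EuclideanSpace ℝ (Fin d)) :
    ENNReal.ofReal (Real.exp (-4 * p * latticeDist a t ^ 2)) ≤
      ENNReal.ofReal (Real.exp (-p * α ^ 2)) + nearLattice a p α t := by
  by_cases ht : latticeDist a t < α / 2
  · rw [nearLattice, Set.indicator_of_mem (by exact ht)]
    exact le_add_self
  · refine le_add_right (ENNReal.ofReal_le_ofReal (Real.exp_le_exp.mpr ?_))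
    have : α ^ 2 ≤ 4 * latticeDist a t ^ 2 := by nlinarith
    nlinarith

lemma integral_gaussian_mul_exp_latticeDist_le {d n : ℕ} (hd : 0 < d)
    {a : Fin n → EuclideanSpace ℝ (Fin d)} (ha : (covMat a).PosDef) {p α D b : ℝ} (hp : 0 < p)
    (hα : 0 < α) (hD : 0 < D) (hb : 0 < b) (hbD : b ≤ d / D ^ 2)
    (hlcd : ∀ (m : Fin n → ℤ) (t : EuclideanSpace ℝ (Fin d)),
        ‖t‖ ≤ D → (∃ k, (1 / 2 : ℝ) ≤ |⟪t, a k⟫|) →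
        α ^ 2 ≤ ∑ k, (⟪t, a k⟫ - m k) ^ 2) :
    ∫ t, Real.exp (-b * ‖t‖ ^ 2) * Real.exp (-4 * p * latticeDist a t ^ 2) ≤
      (Real.pi / b) ^ ((d : ℝ) / 2) * (Real.exp (-p * α ^ 2) +
        (Real.exp (1 / 4) * √2 * √Real.pi) ^ d *
          ((√d / (√p * D)) ^ d * (1 / √(covMat a).det))) := by
  have hd' : (0 : ℝ) < d := by exact_mod_cast hd
  have hcont := continuous_latticeDist a
  have hnear := measurable_nearLattice a p α
  set K := (Real.pi / p) ^ ((d : ℝ) / 2) * (1 / √(covMat a).det) with hK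
  have hK0 : 0 ≤ K := by positivity
  set v : ℝ := (2 * (D / 2) / √d) ^ d with hv
  have hv0 : 0 < v := by positivity
  set I := ∫⁻ t, ENNReal.ofReal (Real.exp (-b * ‖t‖ ^ 2)) * nearLattice a p α t
  have hvI : ENNReal.ofReal v * I ≤ ENNReal.ofReal (Real.exp (b * (D / 2) ^ 2) *
      (2 * Real.pi / b) ^ ((d : ℝ) / 2) * K) := by
    rw [ENNReal.ofReal_mul (by positivity), ENNReal.ofReal_mul (by positivity)]
    refine le_trans ?_ (volume_closedBall_mul_lintegral_gaussian_le hnear hb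
      (setLIntegral_nearLattice_le ha hp hα hD hlcd))
    gcongr
    exact ofReal_pow_le_volume_closedBall hd (by positivity)
  have hreal : v⁻¹ * (Real.exp (b * (D / 2) ^ 2) * (2 * Real.pi / b) ^ ((d : ℝ) / 2) * K) ≤
      (Real.pi / b) ^ ((d : ℝ) / 2) * ((Real.exp (1 / 4) * √2 * √Real.pi) ^ d *
          ((√d / (√p * D)) ^ d * (1 / √(covMat a).det))) := by
    have hexp : Real.exp (b * (D / 2) ^ 2) ≤ Real.exp (1 / 4) ^ d := by
      rw [← Real.exp_nat_mul]
      apply Real.exp_le_exp.mpr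
      have : b * D ^ 2 ≤ d := by rwa [le_div_iff₀ (by positivity)] at hbD
      nlinarith
    rw [hK, Real.rpow_div_two_eq_sqrt _ (by positivity), Real.rpow_div_two_eq_sqrt _ (by positivity),
      Real.rpow_div_two_eq_sqrt _ (by positivity), Real.rpow_natCast, Real.rpow_natCast,
      Real.rpow_natCast, hv, ← inv_pow]
    calc _ ≤ (2 * (D / 2) / √d)⁻¹ ^ d * (Real.exp (1 / 4) ^ d * √(2 * Real.pi / b) ^ d *
          (√(Real.pi / p) ^ d * (1 / √(covMat a).det))) := by gcongr
      _ = ((2 * (D / 2) / √d)⁻¹ * Real.exp (1 / 4) * √(2 * Real.pi / b) * √(Real.pi / p)) ^ d *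
          (1 / √(covMat a).det) := by simp only [mul_pow]; ring
      _ = (√(Real.pi / b) * (Real.exp (1 / 4) * √2 * √Real.pi) * (√d / (√p * D))) ^ d *
          (1 / √(covMat a).det) := by
        congr 2
        rw [mul_div_assoc 2 Real.pi b, Real.sqrt_mul (by positivity),
          Real.sqrt_div' Real.pi hp.le]
        have : √p ≠ 0 := by positivity
        have : √(d : ℝ) ≠ 0 := by positivity
        field_simp
      _ = _ := by simp only [mul_pow]; ring
  have hIle : I ≤ ENNReal.ofReal ((Real.pi / b) ^ ((d : ℝ) / 2) *
      ((Real.exp (1 / 4) * √2 * √Real.pi) ^ d *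
          ((√d / (√p * D)) ^ d * (1 / √(covMat a).det)))) := by
    calc I = ENNReal.ofReal v⁻¹ * (ENNReal.ofReal v * I) := by
          rw [← mul_assoc, ← ENNReal.ofReal_mul (by positivity), inv_mul_cancel₀ hv0.ne',
            ENNReal.ofReal_one, one_mul]
      _ ≤ ENNReal.ofReal v⁻¹ * ENNReal.ofReal (Real.exp (b * (D / 2) ^ 2) *
            (2 * Real.pi / b) ^ ((d : ℝ) / 2) * K) := by gcongr
      _ ≤ _ := by
          rw [← ENNReal.ofReal_mul (by positivity)]
          exact ENNReal.ofReal_le_ofReal hreal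
  rw [integral_eq_lintegral_of_nonneg_ae (Filter.Eventually.of_forall fun t => by positivity)
    (by fun_prop)]
  refine ENNReal.toReal_le_of_le_ofReal (by positivity) ?_
  rw [mul_add, ENNReal.ofReal_add (by positivity) (by positivity)]
  calc ∫⁻ t, ENNReal.ofReal
        (Real.exp (-b * ‖t‖ ^ 2) * Real.exp (-4 * p * latticeDist a t ^ 2))
      ≤ ∫⁻ t, (ENNReal.ofReal (Real.exp (-b * ‖t‖ ^ 2)) * ENNReal.ofReal (Real.exp (-p * α ^ 2)) +
          ENNReal.ofReal (Real.exp (-b * ‖t‖ ^ 2)) * nearLattice a p α t) := by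
        refine lintegral_mono fun t => ?_
        rw [ENNReal.ofReal_mul (Real.exp_pos _).le, ← mul_add]
        gcongr
        exact exp_neg_mul_latticeDist_sq_le a hp hα t
    _ = ENNReal.ofReal ((Real.pi / b) ^ ((d : ℝ) / 2) * Real.exp (-p * α ^ 2)) + I := by
        rw [lintegral_add_left (by fun_prop), lintegral_mul_const _ (by fun_prop),
          lintegral_exp_neg_mul_sq_norm hb, ENNReal.ofReal_mul (by positivity)]
    _ ≤ _ := by gcongr

/-- Rescaling the variable by a factor of modulus at least one only widens the Gaussian. -/
lemma integral_gaussian_mul_exp_latticeDist_smul_le {d n : ℕ} (hd : 0 < d)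
    {a : Fin n → EuclideanSpace ℝ (Fin d)} (ha : (covMat a).PosDef) {p α D w : ℝ} (hp : 0 < p)
    (hα : 0 < α) (hD : 0 < D) (hw : 1 < |w|)
    (hlcd : ∀ (m : Fin n → ℤ) (t : EuclideanSpace ℝ (Fin d)),
        ‖t‖ ≤ D → (∃ k, (1 / 2 : ℝ) ≤ |⟪t, a k⟫|) →
        α ^ 2 ≤ ∑ k, (⟪t, a k⟫ - m k) ^ 2) :
    ∫ t, Real.exp (-(d / D ^ 2) * ‖t‖ ^ 2) * Real.exp (-4 * p * latticeDist a (w • t) ^ 2) ≤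
      (Real.pi / (d / D ^ 2)) ^ ((d : ℝ) / 2) * (Real.exp (-p * α ^ 2) +
        (Real.exp (1 / 4) * √2 * √Real.pi) ^ d *
          ((√d / (√p * D)) ^ d * (1 / √(covMat a).det))) := by
  have hd' : (0 : ℝ) < d := by exact_mod_cast hd
  have hw0 : 0 < |w| := by linarith
  have hw2 : 0 < w ^ 2 := by rw [← sq_abs]; positivity
  set b : ℝ := d / D ^ 2 with hbdef
  have hb : 0 < b := by positivity
  have hbw : b / w ^ 2 ≤ b := by
    apply div_le_self hb.le
    rw [← sq_abs]
    nlinarith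
  have h := integral_gaussian_mul_exp_latticeDist_le hd ha hp hα hD
    (show 0 < b / w ^ 2 by positivity) hbw hlcd
  have hscale := Measure.integral_comp_smul (volume : Measure (EuclideanSpace ℝ (Fin d)))
    (fun u => Real.exp (-(b / w ^ 2) * ‖u‖ ^ 2) * Real.exp (-4 * p * latticeDist a u ^ 2)) w
  have hcongr : ∀ t : EuclideanSpace ℝ (Fin d), -(b / w ^ 2) * ‖w • t‖ ^ 2 = -b * ‖t‖ ^ 2 := by
    intro t
    rw [norm_smul, mul_pow, Real.norm_eq_abs, sq_abs, ← mul_assoc, neg_mul, div_mul_cancel₀ _ hw2.ne']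
  simp only [hcongr] at hscale
  rw [hscale, finrank_euclideanSpace_fin, smul_eq_mul, abs_inv, abs_pow]
  refine (mul_le_mul_of_nonneg_left h (by positivity)).trans (le_of_eq ?_)
  rw [← mul_assoc]
  congr 1
  have : Real.pi / (b / w ^ 2) = |w| ^ 2 * (Real.pi / b) := by
    rw [sq_abs]
    field_simp
  rw [this, Real.rpow_div_two_eq_sqrt _ (by positivity), Real.rpow_div_two_eq_sqrt _ (by positivity),
    Real.sqrt_mul (by positivity), Real.sqrt_sq hw0.le, Real.rpow_natCast, Real.rpow_natCast,
    mul_pow, ← mul_assoc, inv_mul_cancel₀ (by positivity), one_mul]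

theorem stmt_9 :
    ∃ c₁ c₂ : ℝ, 0 < c₁ ∧ 0 < c₂ ∧
      ∀ (d n : ℕ),
      ∀ (ν : Measure ℝ), IsProbabilityMeasure ν →
      ∀ p : ℝ, 0 < p → concFn1 ν 1 ≤ 1 - p →
      ∀ (a : Fin n → EuclideanSpace ℝ (Fin d)),
      (covMat a).PosDef →
      ∀ D α : ℝ, 0 < D → D < d → 0 < α →
      (∀ (m : Fin n → ℤ) (t : EuclideanSpace ℝ (Fin d)),
        ‖t‖ ≤ D → (∃ k, (1 / 2 : ℝ) ≤ |⟪t, a k⟫|) →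
        α ^ 2 ≤ ∑ k, (⟪t, a k⟫ - m k) ^ 2) →
      concFn (sumLaw ν a) (d / D) ≤
        c₁ ^ d * (Real.exp (-c₂ * p * α ^ 2)
          + (Real.sqrt d / (Real.sqrt p * D)) ^ d * (1 / Real.sqrt (covMat a).det)) := by
  refine ⟨Real.exp (Real.pi ^ 2) * (Real.exp (1 / 4) * √2 * √Real.pi), 1, by positivity,
    one_pos, ?_⟩
  intro d n ν hνprob p hp hν a ha D α hD hDd hα hlcd
  have hd' : (0 : ℝ) < d := hD.trans hDd
  have hd : 0 < d := by exact_mod_cast hd'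
  set C : ℝ := Real.exp (1 / 4) * √2 * √Real.pi
  have hC1 : 1 ≤ C := by
    have h1 : 1 ≤ Real.exp (1 / 4) := Real.one_le_exp (by norm_num)
    have h2 : 1 ≤ √2 := Real.one_le_sqrt.mpr (by norm_num)
    have h3 : 1 ≤ √Real.pi := Real.one_le_sqrt.mpr (by linarith [Real.pi_gt_three])
    exact one_le_mul_of_one_le_of_one_le (one_le_mul_of_one_le_of_one_le h1 h2) h3
  set P := (√d / (√p * D)) ^ d * (1 / √(covMat a).det)
  have hP0 : 0 ≤ P := by positivity
  have hsum : IsProbabilityMeasure (sumLaw ν a) :=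
    Measure.isProbabilityMeasure_map (Continuous.measurable (by fun_prop)).aemeasurable
  obtain ⟨m, hm, hmae, hjensen⟩ := exists_conditioned_symmetrization ν hp hν
  have hcont := continuous_latticeDist a
  set b : ℝ := d / D ^ 2 with hbdef
  have hb : 0 < b := by positivity
  let g : EuclideanSpace ℝ (Fin d) → ℝ × ℝ → ℝ := fun t z =>
    Real.exp (-b * ‖t‖ ^ 2) * Real.exp (-4 * p * latticeDist a ((z.1 - z.2) • t) ^ 2)
  have hg1 : ∀ (t : EuclideanSpace ℝ (Fin d)) (z : ℝ × ℝ),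
      Real.exp (-4 * p * latticeDist a ((z.1 - z.2) • t) ^ 2) ≤ 1 := fun t z => by
    rw [Real.exp_le_one_iff]
    have : 0 ≤ p * latticeDist a ((z.1 - z.2) • t) ^ 2 := by positivity
    linarith
  have hgint : Integrable (Function.uncurry g) (volume.prod m) := by
    refine ((integrable_exp_neg_mul_sq_norm hb).comp_fst m).mono' ?_
      (Filter.Eventually.of_forall fun y => ?_)
    · apply Continuous.aestronglyMeasurable
      simp only [g, Function.uncurry_def]
      fun_prop
    · simp only [g, Function.uncurry_def]
      rw [Real.norm_eq_abs, abs_of_nonneg (by positivity)]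
      exact mul_le_of_le_one_right (Real.exp_pos _).le (hg1 _ _)
  have hchar : ∫ t, Real.exp (-b * ‖t‖ ^ 2) * ‖charFun (sumLaw ν a) ((2 * Real.pi) • t)‖ ≤
      (Real.pi / b) ^ ((d : ℝ) / 2) * (Real.exp (-p * α ^ 2) + C ^ d * P) := by
    calc _ ≤ ∫ t, ∫ z, g t z ∂m := by
          refine integral_mono_of_nonneg (Filter.Eventually.of_forall fun t => by positivity)
            hgint.integral_prod_left (Filter.Eventually.of_forall fun t => ?_)
          simp only [g]
          rw [integral_const_mul]
          gcongr
          refine (norm_charFun_sumLaw_le ν a t).trans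
            (hjensen (fun z => latticeDist a ((z.1 - z.2) • t) ^ 2) ?_ (fun z => sq_nonneg _) n
              fun z => latticeDist_sq_le a _)
          fun_prop
      _ = ∫ z, (∫ t, g t z) ∂m := integral_integral_swap hgint
      _ ≤ ∫ _z, (Real.pi / b) ^ ((d : ℝ) / 2) * (Real.exp (-p * α ^ 2) + C ^ d * P) ∂m := by
          have hgint' : Integrable (fun z => ∫ t, g t z) m := hgint.integral_prod_right
          refine integral_mono_ae hgint' (integrable_const _) ?_
          filter_upwards [hmae] with z hz
          exact integral_gaussian_mul_exp_latticeDist_smul_le hd ha hp hα hD hz hlcd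
      _ = _ := by simp
  refine ciSup_le fun x => ?_
  calc _ ≤ _ := measure_closedBall_le_integral_charFun (sumLaw ν a) hb x
    _ ≤ Real.exp (Real.pi ^ 2 / b * (d / D) ^ 2) * ((b / Real.pi) ^ ((d : ℝ) / 2) *
        ((Real.pi / b) ^ ((d : ℝ) / 2) * (Real.exp (-p * α ^ 2) + C ^ d * P))) := by gcongr
    _ = Real.exp (Real.pi ^ 2) ^ d * (Real.exp (-p * α ^ 2) + C ^ d * P) := by
        rw [← mul_assoc ((b / Real.pi) ^ _), ← Real.mul_rpow (by positivity) (by positivity),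
          div_mul_div_cancel₀ Real.pi_ne_zero, div_self hb.ne', Real.one_rpow, one_mul,
          ← Real.exp_nat_mul]
        congr 2
        rw [hbdef]
        field_simp
    _ ≤ Real.exp (Real.pi ^ 2) ^ d * (C ^ d * Real.exp (-p * α ^ 2) + C ^ d * P) := by
        gcongr
        exact le_mul_of_one_le_left (Real.exp_pos _).le (one_le_pow₀ hC1)
    _ = _ := by
        rw [mul_pow, show -1 * p * α ^ 2 = -p * α ^ 2 by ring]
        ring
end
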